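/- arXiv:2308.13186 — 2 statements merged into one kernel-verified Lean document; each statement's English description precedes it below -/
import Mathlib

section
/- The set C_m = {c ∈ R : Kdim(R/cR) < m} is a multiplicatively closed subset of regular elements of R. -/
set_option linter.unusedVariables false

/-- `devLE k A` : the deviation (in the Gabriel–Rentschler sense) of the
poset `A` is `≤ k` (for `k : ℕ`).  `devLE 0 A` says every descending chain
eventually stabilizes (DCC), and `devLE (k+1) A` says that in any descending
chain all but finitely many of the factor intervals have deviation `≤ k`. -/
def devLE : ℕ → (A : Type*) → [inst : Preorder A] → Prop
  | 0, A, _ => ∀ f : ℕ → A, Antitone f → ∃ N, ∀ i, N ≤ i → f (i + 1) = f i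
  | (k+1), A, _ => ∀ f : ℕ → A, Antitone f →
      ∃ N, ∀ i, N ≤ i → devLE k (Set.Icc (f (i + 1)) (f i))

/-- The Gabriel–Rentschler Krull dimension of the right `R`-module `M`
(a module over `Rᵐᵒᵖ`) is `≤ k` : the deviation of its submodule lattice is `≤ k`. -/
def kdimLE (R M : Type*) [Ring R] [AddCommGroup M] [Module Rᵐᵒᵖ M] (k : ℕ) : Prop :=
  devLE k (Submodule Rᵐᵒᵖ M)

/-- `c` is a regular element of `R` (neither a left nor a right zero divisor). -/
def regElem (R : Type*) [Ring R] (c : R) : Prop :=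
  (∀ x : R, c * x = 0 → x = 0) ∧ (∀ x : R, x * c = 0 → x = 0)

/-- `C_m = {c ∈ R | Kdim(R/cR) < m}` (for `0 < m`, `Kdim < m` is `Kdim ≤ m-1`). -/
def rCm (R : Type*) [Ring R] (m : ℕ) : Set R :=
  {c | kdimLE R (R ⧸ Submodule.span Rᵐᵒᵖ ({c} : Set R)) (m - 1)}

/-- The m-Gabriel filter `g = {right ideals I | Kdim(R/I) < m}`. -/
def gFilt (R : Type*) [Ring R] (m : ℕ) : Set (Submodule Rᵐᵒᵖ R) :=
  {I | kdimLE R (R ⧸ I) (m - 1)}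

/-- A right ideal `P` is a (two-sided) prime ideal of `R`. -/
def isTwoSidedPrime (R : Type*) [Ring R] (P : Submodule Rᵐᵒᵖ R) : Prop :=
  (∀ a ∈ P, ∀ r : R, r * a ∈ P) ∧ P ≠ ⊤ ∧
    ∀ a b : R, (∀ r : R, a * r * b ∈ P) → a ∈ P ∨ b ∈ P

/-- `c ∈ C(P)` : `c` is regular modulo `P`. -/
def regModP (R : Type*) [Ring R] (P : Submodule Rᵐᵒᵖ R) (c : R) : Prop :=
  ∀ x : R, (c * x ∈ P → x ∈ P) ∧ (x * c ∈ P → x ∈ P)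

/-- `X_m` : the set of (two-sided) prime ideals `P` with `Kdim(R/P) = m`. -/
def xSet (R : Type*) [Ring R] (m : ℕ) : Set (Submodule Rᵐᵒᵖ R) :=
  {P | isTwoSidedPrime R P ∧ kdimLE R (R ⧸ P) m ∧ ¬ kdimLE R (R ⧸ P) (m - 1)}

/-- `V_m = ⋂_{P ∈ X_m} C(P)`. -/
def vSet (R : Type*) [Ring R] (m : ℕ) : Set R :=
  {v | ∀ P ∈ xSet R m, regModP R P v}

/-- Left multiplication by `a` as a right-module (`Rᵐᵒᵖ`-module) endomorphism of `R`. -/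
def lmulHom (R : Type*) [Ring R] (a : R) : R →ₗ[Rᵐᵒᵖ] R where
  toFun x := a * x
  map_add' x y := mul_add a x y
  map_smul' r x := by
    simp [MulOpposite.smul_eq_mul_unop, mul_assoc]

/-- `Q` is a classical right quotient ring of `R` via `f : R →+* Q` :
`f` is injective, regular elements of `R` become units in `Q`, and every
element of `Q` is a right fraction `f a * (f s)⁻¹`. -/
def isRightQuotientRing (R Q : Type*) [Ring R] [Ring Q] (f : R →+* Q) : Prop :=
  Function.Injective f ∧ (∀ s : R, regElem R s → IsUnit (f s)) ∧
    ∀ q : Q, ∃ a s : R, regElem R s ∧ q * f s = f a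

/-- `R^e = {q ∈ Q | qJ ⊆ R for some J in the m-Gabriel filter}`, as a subset of `Q`. -/
def reSet (R Q : Type*) [Ring R] [Ring Q] (f : R →+* Q) (m : ℕ) : Set Q :=
  {q | ∃ J ∈ gFilt R m, ∀ j ∈ J, ∃ r : R, q * f j = f r}

/-- The extension `A·R^e` of a set `A ⊆ R` : the additive subgroup of `Q`
generated by products `f a * q` with `a ∈ A`, `q ∈ R^e` (a right ideal of `R^e`). -/
def extSet (R Q : Type*) [Ring R] [Ring Q] (f : R →+* Q) (m : ℕ) (A : Set R) : Set Q :=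
  (AddSubgroup.closure {x : Q | ∃ a ∈ A, ∃ q ∈ reSet R Q f m, x = f a * q} : Set Q)

/-- The right `R`-module structure on `Q` induced by `f : R →+* Q`. -/
def qMod (R Q : Type*) [Ring R] [Ring Q] (f : R →+* Q) : Module Rᵐᵒᵖ Q :=
  Module.compHom Q (RingHom.op f)

section Deviation

theorem devLE_of_strictMono {A B : Type*} [PartialOrder A] [PartialOrder B] (k : ℕ)
    (g : A → B) (hg : StrictMono g) (h : devLE k B) : devLE k A := by
  induction k generalizing A B with
  | zero =>
    intro f hf
    obtain ⟨N, hN⟩ := h (g ∘ f) (hg.monotone.comp_antitone hf)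
    refine ⟨N, fun i hi => ?_⟩
    by_contra hne
    exact (hg (lt_of_le_of_ne (hf (Nat.le_succ i)) hne)).ne (hN i hi)
  | succ k ih =>
    intro f hf
    obtain ⟨N, hN⟩ := h (g ∘ f) (hg.monotone.comp_antitone hf)
    exact ⟨N, fun i hi => ih (fun x : Set.Icc (f (i + 1)) (f i) =>
      (⟨g x, hg.monotone x.2.1, hg.monotone x.2.2⟩ : Set.Icc (g (f (i + 1))) (g (f i))))
      (fun _ _ hxy => hg hxy) (hN i hi)⟩

theorem devLE_of_subsingleton {A : Type*} [PartialOrder A] [Subsingleton A] (k : ℕ) :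
    devLE k A := by
  induction k generalizing A with
  | zero => exact fun _ _ => ⟨0, fun _ _ => Subsingleton.elim _ _⟩
  | succ k ih => exact fun _ _ => ⟨0, fun _ _ => ih⟩

theorem devLE_Ici_top {A : Type*} [PartialOrder A] [OrderTop A] (k : ℕ) :
    devLE k (Set.Ici (⊤ : A)) :=
  have : Subsingleton (Set.Ici (⊤ : A)) :=
    ⟨fun x y => Subtype.ext ((top_le_iff.mp x.2).trans (top_le_iff.mp y.2).symm)⟩
  devLE_of_subsingleton k

theorem devLE_succ {A : Type*} [PartialOrder A] (k : ℕ) (h : devLE k A) :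
    devLE (k + 1) A := by
  induction k generalizing A with
  | zero =>
    intro f hf
    obtain ⟨N, hN⟩ := h f hf
    refine ⟨N, fun i hi => ?_⟩
    rw [hN i hi]
    exact devLE_of_subsingleton 0
  | succ k ih =>
    intro f hf
    obtain ⟨N, hN⟩ := h f hf
    exact ⟨N, fun i hi => ih (hN i hi)⟩

theorem devLE_mono {A : Type*} [PartialOrder A] {k l : ℕ} (hkl : k ≤ l) (h : devLE k A) :
    devLE l A := by
  induction l, hkl using Nat.le_induction with
  | base => exact h
  | succ l _ ih => exact devLE_succ l ih

theorem devLE_prod {A B : Type*} [PartialOrder A] [PartialOrder B] (k : ℕ)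
    (hA : devLE k A) (hB : devLE k B) : devLE k (A × B) := by
  induction k generalizing A B with
  | zero =>
    intro f hf
    obtain ⟨N, hN⟩ := hA (fun i => (f i).1) fun _ _ hij => (hf hij).1
    obtain ⟨M, hM⟩ := hB (fun i => (f i).2) fun _ _ hij => (hf hij).2
    exact ⟨max N M, fun i hi => Prod.ext (hN i (le_trans (le_max_left _ _) hi))
      (hM i (le_trans (le_max_right _ _) hi))⟩
  | succ k ih =>
    intro f hf
    obtain ⟨N, hN⟩ := hA (fun i => (f i).1) fun _ _ hij => (hf hij).1
    obtain ⟨M, hM⟩ := hB (fun i => (f i).2) fun _ _ hij => (hf hij).2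
    refine ⟨max N M, fun i hi => ?_⟩
    refine devLE_of_strictMono k
      (fun x : Set.Icc (f (i + 1)) (f i) =>
        ((⟨x.1.1, x.2.1.1, x.2.2.1⟩, ⟨x.1.2, x.2.1.2, x.2.2.2⟩) :
          Set.Icc (f (i + 1)).1 (f i).1 × Set.Icc (f (i + 1)).2 (f i).2))
      ?_ (ih (hN i (le_trans (le_max_left _ _) hi)) (hM i (le_trans (le_max_right _ _) hi)))
    exact fun _ _ hxy => hxy

/-- Deviation of an upper interval from the deviations of its two pieces. -/
theorem devLE_Ici_of_le {L : Type*} [Lattice L] [IsModularLattice L] (k : ℕ) {a b : L}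
    (hab : a ≤ b) (h₁ : devLE k (Set.Icc a b)) (h₂ : devLE k (Set.Ici b)) :
    devLE k (Set.Ici a) := by
  refine devLE_of_strictMono k
    (fun x : Set.Ici a =>
      ((⟨x.1 ⊓ b, le_inf x.2 hab, inf_le_right⟩, ⟨x.1 ⊔ b, le_sup_right⟩) :
        Set.Icc a b × Set.Ici b)) ?_ (devLE_prod k h₁ h₂)
  intro x y hxy
  exact (strictMono_inf_prod_sup (z := b) (show x.1 < y.1 from hxy) :)

theorem devLE_Ici_inf {L : Type*} [Lattice L] [IsModularLattice L] (k : ℕ) {a b : L}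
    (ha : devLE k (Set.Ici a)) (hb : devLE k (Set.Ici b)) : devLE k (Set.Ici (a ⊓ b)) := by
  refine devLE_Ici_of_le k inf_le_left ?_ ha
  refine devLE_of_strictMono k (fun x : Set.Icc (a ⊓ b) a =>
    (⟨(infIccOrderIsoIccSup a b x).1, (infIccOrderIsoIccSup a b x).2.1⟩ : Set.Ici b)) ?_ hb
  exact fun x y hxy => (infIccOrderIsoIccSup a b).strictMono hxy

theorem devLE_Iic_of_disjoint {L : Type*} [Lattice L] [IsModularLattice L] [OrderBot L] (k : ℕ)
    {a b : L} (hab : a ⊓ b = ⊥) (hb : devLE k (Set.Ici b)) : devLE k (Set.Iic a) := by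
  have h : devLE k (Set.Icc (a ⊓ b) a) :=
    devLE_of_strictMono k (fun x : Set.Icc (a ⊓ b) a =>
      (⟨(infIccOrderIsoIccSup a b x).1, (infIccOrderIsoIccSup a b x).2.1⟩ : Set.Ici b))
      (fun x y hxy => (infIccOrderIsoIccSup a b).strictMono hxy) hb
  exact devLE_of_strictMono k (fun x : Set.Iic a =>
    (⟨x.1, hab ▸ bot_le, x.2⟩ : Set.Icc (a ⊓ b) a)) (fun _ _ hxy => hxy) h

end Deviation

section Submodules

variable {S M N : Type*} [Ring S] [AddCommGroup M] [AddCommGroup N] [Module S M] [Module S N]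

theorem Submodule.comap_lt_comap_of_le_range (φ : M →ₗ[S] N) {x y : Submodule S N}
    (hy : y ≤ LinearMap.range φ) (hxy : x < y) : x.comap φ < y.comap φ := by
  refine lt_of_le_of_ne (Submodule.comap_mono hxy.le) fun h => hxy.ne ?_
  rw [← Submodule.map_comap_eq_self hy, ← Submodule.map_comap_eq_self (hxy.le.trans hy), h]

theorem devLE_Iic_range_of_le_ker (φ : M →ₗ[S] N) (k : ℕ) {I : Submodule S M}
    (hI : I ≤ LinearMap.ker φ) (h : devLE k (Set.Ici I)) :
    devLE k (Set.Iic (LinearMap.range φ)) :=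
  devLE_of_strictMono k (fun x : Set.Iic (LinearMap.range φ) =>
    (⟨x.1.comap φ, hI.trans (LinearMap.ker_le_comap φ)⟩ : Set.Ici I))
    (fun _ y hxy => Submodule.comap_lt_comap_of_le_range φ y.2 hxy) h

theorem devLE_Ici_ker (φ : M →ₗ[S] N) (k : ℕ) (h : devLE k (Set.Iic (LinearMap.range φ))) :
    devLE k (Set.Ici (LinearMap.ker φ)) := by
  refine devLE_of_strictMono k (fun x : Set.Ici (LinearMap.ker φ) =>
    (⟨x.1.map φ, LinearMap.map_le_range⟩ : Set.Iic (LinearMap.range φ))) ?_ h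
  intro x y hxy
  refine lt_of_le_of_ne (Submodule.map_mono (f := φ) hxy.le) fun he => hxy.ne (Subtype.ext ?_)
  have he' : x.1.map φ = y.1.map φ := congrArg Subtype.val he
  rw [← Submodule.comap_map_eq_self x.2, ← Submodule.comap_map_eq_self y.2, he']

theorem devLE_Iic_map (φ : M →ₗ[S] N) (k : ℕ) (U : Submodule S M) (h : devLE k (Set.Iic U)) :
    devLE k (Set.Iic (U.map φ)) := by
  refine devLE_of_strictMono k (fun x : Set.Iic (U.map φ) =>
    (⟨x.1.comap φ ⊓ U, Set.mem_Iic.mpr inf_le_right⟩ : Set.Iic U)) ?_ h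
  have key (x : Set.Iic (U.map φ)) : (x.1.comap φ ⊓ U).map φ = x.1 := by
    refine le_antisymm ((Submodule.map_mono inf_le_left).trans (Submodule.map_comap_le _ _)) ?_
    intro t ht
    obtain ⟨u, hu, rfl⟩ := x.2 ht
    exact ⟨u, ⟨ht, hu⟩, rfl⟩
  intro x y hxy
  refine lt_of_le_of_ne (inf_le_inf_right U (Submodule.comap_mono hxy.le)) fun he => hxy.ne ?_
  apply Subtype.ext
  rw [← key x, ← key y]
  exact congrArg (Submodule.map φ) (congrArg Subtype.val he)

theorem devLE_Ici_range_comp (φ ψ : M →ₗ[S] M) (k : ℕ)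
    (hφ : devLE k (Set.Ici (LinearMap.range φ))) (hψ : devLE k (Set.Ici (LinearMap.range ψ))) :
    devLE k (Set.Ici (LinearMap.range (φ ∘ₗ ψ))) := by
  refine devLE_Ici_of_le k (LinearMap.range_comp_le_range ψ φ) ?_ hφ
  refine devLE_of_strictMono k
    (fun x : Set.Icc (LinearMap.range (φ ∘ₗ ψ)) (LinearMap.range φ) =>
      (⟨x.1.comap φ, ?_⟩ : Set.Ici (LinearMap.range ψ))) ?_ hψ
  · rintro _ ⟨t, rfl⟩
    exact x.2.1 ⟨t, rfl⟩
  · exact fun _ y hxy => Submodule.comap_lt_comap_of_le_range φ y.2.2 hxy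

/-- A Fitting-type argument: an endomorphism of a noetherian module whose cokernel has small
Krull dimension is injective as soon as no nonzero submodule has such a small dimension. -/
theorem LinearMap.ker_eq_bot_of_devLE [IsNoetherian S M] (φ : M →ₗ[S] M) (k : ℕ)
    (hφ : devLE k (Set.Ici (LinearMap.range φ)))
    (hM : ∀ U : Submodule S M, devLE k (Set.Iic U) → U = ⊥) : LinearMap.ker φ = ⊥ := by
  have hpow (j : ℕ) : devLE k (Set.Ici (LinearMap.range (φ ^ (j + 1)))) := by
    induction j with
    | zero => rwa [zero_add, pow_one]
    | succ j ih =>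
      rw [pow_succ]
      exact devLE_Ici_range_comp _ φ k ih hφ
  obtain ⟨j, hj⟩ :=
    Filter.eventually_atTop.mp (Module.End.eventually_disjoint_ker_pow_range_pow φ)
  have hbot := hM _ (devLE_Iic_of_disjoint k (hj (j + 1) j.le_succ).eq_bot (hpow j))
  refine eq_bot_iff.mpr (hbot ▸ fun x hx => ?_)
  rw [LinearMap.mem_ker] at hx ⊢
  rw [pow_succ, Module.End.mul_apply, hx, map_zero]

end Submodules

section Prime

variable {R : Type*} [Ring R]

theorem lmulHom_apply (a x : R) : lmulHom R a x = a * x := rfl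

theorem range_lmulHom (a : R) : LinearMap.range (lmulHom R a) = Submodule.span Rᵐᵒᵖ {a} := by
  ext x
  rw [Submodule.mem_span_singleton]
  exact ⟨fun ⟨y, hy⟩ => ⟨MulOpposite.op y, hy⟩, fun ⟨y, hy⟩ => ⟨y.unop, hy⟩⟩

theorem lmulHom_mul (a b : R) : lmulHom R (a * b) = lmulHom R a ∘ₗ lmulHom R b :=
  LinearMap.ext fun x => mul_assoc a b x

/-- In a prime right noetherian ring every nonzero right ideal `bR` contains a nonzero `a` with
`aR ∩ r.ann(a) = 0`; in particular it is not nil (Levitzki's theorem, by Utumi's argument). -/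
theorem exists_mul_ne_zero_of_sq [IsNoetherian Rᵐᵒᵖ R]
    (hprime : ∀ a b : R, (∀ r : R, a * r * b = 0) → a = 0 ∨ b = 0) {b : R} (hb : b ≠ 0) :
    ∃ y, b * y ≠ 0 ∧ ∀ r, b * y * (b * y * r) = 0 → b * y * r = 0 := by
  obtain ⟨_, ⟨a, rfl, ⟨y, rfl⟩, ha⟩, hmax⟩ :=
    (wellFounded_gt (α := Submodule Rᵐᵒᵖ R)).has_min
      {I | ∃ a, LinearMap.ker (lmulHom R a) = I ∧ (∃ y, a = y * b) ∧ a ≠ 0}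
      ⟨_, b, rfl, ⟨1, (one_mul b).symm⟩, hb⟩
  have hann (w : R) (hw : w * (y * b) ≠ 0) (r : R) (hr : w * (y * b) * r = 0) :
      y * b * r = 0 := by
    have hle : LinearMap.ker (lmulHom R (y * b)) ≤ LinearMap.ker (lmulHom R (w * (y * b))) := by
      intro t ht
      rw [LinearMap.mem_ker, lmulHom_apply] at ht ⊢
      rw [mul_assoc, ht, mul_zero]
    by_contra hne
    refine hmax _ ⟨w * (y * b), rfl, ⟨w * y, (mul_assoc _ _ _).symm⟩, hw⟩
      (lt_of_le_of_ne hle fun he => hne ?_)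
    exact (he ▸ (show r ∈ LinearMap.ker (lmulHom R (w * (y * b))) from hr) :
      r ∈ LinearMap.ker (lmulHom R (y * b)))
  obtain ⟨x, hx⟩ : ∃ x, y * b * x * (y * b) ≠ 0 := by
    by_contra! h
    exact (hprime _ _ h).elim ha ha
  have hc : x * (y * b) ≠ 0 := fun h => hx (by rw [mul_assoc, h, mul_zero])
  set z := x * y with hz
  have hcz : z * b ≠ 0 := by rwa [hz, mul_assoc]
  have cancel (r : R) (hr : z * b * (z * b * r) = 0) : z * b * r = 0 := by
    have h1 : x * (y * b) * (x * (y * b)) ≠ 0 := fun h => hx (by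
      simpa only [mul_assoc] using hann x hc (x * (y * b)) h)
    have h2 := hann (z * b * x) (by simpa only [hz, mul_assoc] using h1) r
      (by simpa only [hz, mul_assoc] using hr)
    rw [hz, mul_assoc x, mul_assoc x, h2, mul_zero]
  refine ⟨z * b * z, fun h => hcz ?_, fun r hr => ?_⟩
  · have h3 : z * b * (z * b * (z * b * 1)) = 0 := by
      calc _ = z * (b * (z * b * z)) * b := by noncomm_ring
        _ = 0 := by rw [h]; simp
    simpa using cancel 1 (cancel _ h3)
  · have h4 : z * b * (z * b * (z * b * (z * b * (z * r)))) = 0 := by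
      calc _ = z * (b * (z * b * z) * (b * (z * b * z) * r)) := by noncomm_ring
        _ = 0 := by rw [hr, mul_zero]
    have h5 := cancel _ (cancel _ (cancel _ h4))
    calc _ = b * (z * b * (z * r)) := by noncomm_ring
      _ = 0 := by rw [h5, mul_zero]

/-- A nonzero right ideal of a prime right noetherian ring has the Krull dimension of the ring. -/
theorem devLE_of_devLE_Iic [IsNoetherian Rᵐᵒᵖ R]
    (hprime : ∀ a b : R, (∀ r : R, a * r * b = 0) → a = 0 ∨ b = 0) (k : ℕ)
    {U : Submodule Rᵐᵒᵖ R} (hU : U ≠ ⊥) (h : devLE k (Set.Iic U)) :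
    devLE k (Submodule Rᵐᵒᵖ R) := by
  obtain ⟨u, huU, hu⟩ := (Submodule.ne_bot_iff U).mp hU
  obtain ⟨I, ⟨A, hIA, hA⟩, hmax⟩ := (wellFounded_gt (α := Submodule Rᵐᵒᵖ R)).has_min
    {I | ∃ A : Submodule Rᵐᵒᵖ R, I ⊓ A = ⊥ ∧ devLE k (Set.Ici A)}
    ⟨⊥, ⊤, bot_inf_eq _, devLE_Ici_top k⟩
  by_cases hA0 : A = ⊥
  · subst hA0
    exact devLE_of_strictMono k
      (fun x => (⟨x, Set.mem_Ici.mpr bot_le⟩ : Set.Ici (⊥ : Submodule Rᵐᵒᵖ R))) (fun _ _ hxy => hxy) hA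
  obtain ⟨x, hxA, hx⟩ := (Submodule.ne_bot_iff A).mp hA0
  obtain ⟨s, hs⟩ : ∃ s, x * s * u ≠ 0 := by
    by_contra! h0
    exact (hprime _ _ h0).elim hx hu
  obtain ⟨y, hne, hy⟩ := exists_mul_ne_zero_of_sq hprime hs
  set a := x * s * u * y with ha
  have haA : a ∈ A := by
    have := A.smul_mem (MulOpposite.op (s * u * y)) hxA
    rwa [MulOpposite.smul_eq_mul_unop, MulOpposite.unop_op, ← mul_assoc, ← mul_assoc] at this
  have hrange : LinearMap.range (lmulHom R a) ≤ U.map (lmulHom R (x * s)) := by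
    rintro _ ⟨t, rfl⟩
    exact ⟨u * (y * t), U.smul_mem (MulOpposite.op (y * t)) huU, by
      simp only [lmulHom_apply, ha, mul_assoc]⟩
  have hdev : devLE k (Set.Ici (LinearMap.ker (lmulHom R a))) :=
    devLE_Ici_ker _ k (devLE_of_strictMono k
      (fun t : Set.Iic (LinearMap.range (lmulHom R a)) =>
        (⟨t.1, le_trans t.2 hrange⟩ : Set.Iic (U.map (lmulHom R (x * s)))))
      (fun _ _ hxy => hxy) (devLE_Iic_map _ k U h))
  have hnot : a ∉ I := fun haI => hne ((Submodule.mem_bot Rᵐᵒᵖ).mp (hIA ▸ ⟨haI, haA⟩))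
  refine absurd ?_ (hmax (I ⊔ Submodule.span Rᵐᵒᵖ {a})
    ⟨A ⊓ LinearMap.ker (lmulHom R a), ?_, devLE_Ici_inf k hA hdev⟩)
  · refine lt_of_le_of_ne le_sup_left fun he => hnot ?_
    rw [he]
    exact Submodule.mem_sup_right (Submodule.mem_span_singleton_self a)
  · refine eq_bot_iff.mpr ?_
    rintro t ⟨ht, htA, htk⟩
    obtain ⟨i, hi, w, hw, rfl⟩ := Submodule.mem_sup.mp ht
    obtain ⟨r, rfl⟩ := Submodule.mem_span_singleton.mp hw
    have hiA : i ∈ A := (Submodule.add_mem_iff_left A (A.smul_mem r haA)).mp htA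
    have hi0 : i = 0 := (Submodule.mem_bot Rᵐᵒᵖ).mp (hIA ▸ ⟨hi, hiA⟩)
    subst hi0
    rw [zero_add] at htk ⊢
    exact hy r.unop htk

theorem mem_rCm_iff (m : ℕ) (c : R) :
    c ∈ rCm R m ↔ devLE (m - 1) (Set.Ici (LinearMap.range (lmulHom R c))) := by
  rw [range_lmulHom]
  let e := Submodule.comapMkQRelIso (Submodule.span Rᵐᵒᵖ ({c} : Set R))
  exact ⟨devLE_of_strictMono _ e.symm e.symm.strictMono, devLE_of_strictMono _ e e.strictMono⟩

end Prime

theorem stmt0 (R : Type) [Ring R] [Nontrivial R] [IsNoetherian Rᵐᵒᵖ R]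
    (hprime : ∀ a b : R, (∀ r : R, a * r * b = 0) → a = 0 ∨ b = 0)
    (n m : ℕ) (hm : 0 < m) (hmn : m < n)
    (hdim : kdimLE R R n ∧ ¬ kdimLE R R (n - 1)) :
    (∀ c ∈ rCm R m, regElem R c) ∧ (1 : R) ∈ rCm R m ∧
      ∀ c ∈ rCm R m, ∀ d ∈ rCm R m, c * d ∈ rCm R m := by
  have hbot (U : Submodule Rᵐᵒᵖ R) (hU : devLE (m - 1) (Set.Iic U)) : U = ⊥ := by
    by_contra hne
    exact hdim.2 (devLE_mono (Nat.sub_le_sub_right hmn.le 1) (devLE_of_devLE_Iic hprime _ hne hU))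
  refine ⟨fun c hc => ⟨fun x hx => ?_, fun x hx => ?_⟩, ?_, fun c hc d hd => ?_⟩
  · rw [mem_rCm_iff] at hc
    exact LinearMap.ker_eq_bot'.mp (LinearMap.ker_eq_bot_of_devLE _ _ hc hbot) x hx
  · rw [mem_rCm_iff] at hc
    have hle : LinearMap.range (lmulHom R c) ≤ LinearMap.ker (lmulHom R x) := by
      rintro _ ⟨t, rfl⟩
      rw [LinearMap.mem_ker, lmulHom_apply, lmulHom_apply, ← mul_assoc, hx, zero_mul]
    have h0 := hbot _ (devLE_Iic_range_of_le_ker _ _ hle hc)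
    rw [range_lmulHom] at h0
    exact Submodule.span_singleton_eq_bot.mp h0
  · rw [mem_rCm_iff, LinearMap.range_eq_top.mpr fun x => ⟨x, one_mul x⟩]
    exact devLE_Ici_top _
  · rw [mem_rCm_iff] at hc hd ⊢
    rw [lmulHom_mul]
    exact devLE_Ici_range_comp _ _ _ hc hd
end

section
/- With c = {right ideals I : I ∩ C_m ≠ ∅}, g = {right ideals I : Kdim(R/I) < m}, and h = {right ideals I : I ∩ C(P) ≠ ∅ for every P ∈ X_m}, one has c ⊆ g ⊆ h. -/
set_option linter.unusedVariables false

/-- Deviation bounds pull back along strictly monotone maps. -/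
theorem devLE.of_strictMono {A B : Type*} [PartialOrder A] [PartialOrder B] {k : ℕ}
    (φ : A → B) (hφ : StrictMono φ) (h : devLE k B) : devLE k A := by
  induction k generalizing A B with
  | zero =>
    intro f hf
    obtain ⟨N, hN⟩ := h (φ ∘ f) (hφ.monotone.comp_antitone hf)
    refine ⟨N, fun i hi => ?_⟩
    by_contra hne
    exact (hφ (lt_of_le_of_ne (hf (Nat.le_succ i)) hne)).ne (hN i hi)
  | succ k ih =>
    intro f hf
    obtain ⟨N, hN⟩ := h (φ ∘ f) (hφ.monotone.comp_antitone hf)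
    refine ⟨N, fun i hi => ih (fun x => ⟨φ x.1, hφ.monotone x.2.1, hφ.monotone x.2.2⟩) ?_
      (hN i hi)⟩
    intro x y hxy
    exact hφ hxy

/-- The deviation of a product is bounded by a common bound of the factors. -/
theorem devLE.prod {A B : Type*} [PartialOrder A] [PartialOrder B] {k : ℕ}
    (hA : devLE k A) (hB : devLE k B) : devLE k (A × B) := by
  induction k generalizing A B with
  | zero =>
    intro f hf
    obtain ⟨N, hN⟩ := hA (fun i => (f i).1) (fun i j hij => (hf hij).1)
    obtain ⟨M, hM⟩ := hB (fun i => (f i).2) (fun i j hij => (hf hij).2)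
    exact ⟨max N M, fun i hi => Prod.ext (hN i (le_of_max_le_left hi))
      (hM i (le_of_max_le_right hi))⟩
  | succ k ih =>
    intro f hf
    obtain ⟨N, hN⟩ := hA (fun i => (f i).1) (fun i j hij => (hf hij).1)
    obtain ⟨M, hM⟩ := hB (fun i => (f i).2) (fun i j hij => (hf hij).2)
    refine ⟨max N M, fun i hi => devLE.of_strictMono
      (fun x => (⟨x.1.1, x.2.1.1, x.2.2.1⟩, ⟨x.1.2, x.2.1.2, x.2.2.2⟩)) ?_
      (ih (hN i (le_of_max_le_left hi)) (hM i (le_of_max_le_right hi)))⟩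
    intro x y hxy
    exact hxy

/-- In a modular lattice, the deviation of the interval below a join is bounded by a common
bound for the two joinands. -/
theorem devLE.Iic_sup {L : Type*} [Lattice L] [IsModularLattice L] {k : ℕ} {a b : L}
    (ha : devLE k (Set.Iic a)) (hb : devLE k (Set.Iic b)) : devLE k (Set.Iic (a ⊔ b)) := by
  have hmod : ∀ x : L, x ≤ a ⊔ b → (x ⊔ a) ⊓ b ⊔ a = x ⊔ a := by
    intro x hx
    rw [inf_sup_assoc_of_le b le_sup_right, sup_comm b a, inf_eq_left]
    exact sup_le hx le_sup_left
  refine devLE.of_strictMono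
    (fun x => (⟨x.1 ⊓ a, inf_le_right⟩, ⟨(x.1 ⊔ a) ⊓ b, inf_le_right⟩)) ?_ (ha.prod hb)
  intro x y hxy
  have hle : x.1 ≤ y.1 := hxy.le
  refine lt_of_le_of_ne ⟨inf_le_inf_right a hle, inf_le_inf_right b (sup_le_sup_right hle a)⟩ ?_
  intro h
  have h1 : x.1 ⊓ a = y.1 ⊓ a := congrArg (fun p => p.1.1) h
  have h2 : (x.1 ⊔ a) ⊓ b = (y.1 ⊔ a) ⊓ b := congrArg (fun p => p.2.1) h
  have h3 : x.1 ⊔ a = y.1 ⊔ a := by rw [← hmod x.1 x.2, ← hmod y.1 y.2, h2]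
  exact hxy.ne (Subtype.ext (eq_of_le_of_inf_le_of_sup_le hle h1.ge h3.ge))

/-- In a modular lattice, the interval below an element disjoint from `b` has deviation bounded
by that of the interval above `b`. -/
theorem devLE.Iic_of_Ici {L : Type*} [Lattice L] [OrderBot L] [IsModularLattice L] {k : ℕ}
    {u b : L} (hub : Disjoint u b) (hb : devLE k (Set.Ici b)) : devLE k (Set.Iic u) := by
  refine devLE.of_strictMono (fun x => ⟨x.1 ⊔ b, le_sup_right⟩) ?_ hb
  intro x y hxy
  have hle : x.1 ≤ y.1 := hxy.le
  refine lt_of_le_of_ne (sup_le_sup_right hle b) ?_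
  intro h
  have h1 : x.1 ⊔ b = y.1 ⊔ b := congrArg (fun p => p.1) h
  have h2 : y.1 ⊓ b ≤ x.1 ⊓ b :=
    ((hub.mono_left y.2).le_bot).trans bot_le
  exact hxy.ne (Subtype.ext (eq_of_le_of_inf_le_of_sup_le hle h2 h1.ge))

/-- The Krull dimension of a quotient module is the deviation of the interval above the
submodule. -/
theorem kdimLE_quotient_iff {R M : Type*} [Ring R] [AddCommGroup M] [Module Rᵐᵒᵖ M]
    (N : Submodule Rᵐᵒᵖ M) (k : ℕ) : kdimLE R (M ⧸ N) k ↔ devLE k (Set.Ici N) :=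
  ⟨devLE.of_strictMono _ (Submodule.comapMkQRelIso N).symm.strictMono,
    devLE.of_strictMono _ (Submodule.comapMkQRelIso N).strictMono⟩

/-- The Krull dimension of the image of a submodule does not exceed that of the submodule. -/
theorem devLE.Iic_map {R M N : Type*} [Ring R] [AddCommGroup M] [Module R M] [AddCommGroup N]
    [Module R N] {k : ℕ} (f : M →ₗ[R] N) {D : Submodule R M} (hD : devLE k (Set.Iic D)) :
    devLE k (Set.Iic (D.map f)) := by
  refine devLE.of_strictMono (fun X => ⟨D ⊓ X.1.comap f, Set.mem_Iic.2 inf_le_left⟩) ?_ hD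
  refine Monotone.strictMono_of_injective
    (fun X Y h => inf_le_inf_left D (Submodule.comap_mono h)) ?_
  intro X Y h
  have h1 : D ⊓ X.1.comap f = D ⊓ Y.1.comap f := congrArg (fun p => p.1) h
  have key : ∀ Z : Submodule R N, Z ≤ D.map f → (D ⊓ Z.comap f).map f = Z := by
    refine fun Z hZ => le_antisymm (Submodule.map_le_iff_le_comap.2 inf_le_right) fun z hz => ?_
    obtain ⟨d, hd, rfl⟩ := hZ hz
    exact ⟨d, ⟨hd, hz⟩, rfl⟩
  exact Subtype.ext (by rw [← key X.1 X.2, h1, key Y.1 Y.2])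

section Goldie

variable {S : Type*} [Ring S]

/-- The right annihilator of `a`. -/
abbrev rightAnn (a : S) : Submodule Sᵐᵒᵖ S := LinearMap.ker (lmulHom S a)

theorem mem_rightAnn {a x : S} : x ∈ rightAnn a ↔ a * x = 0 := Iff.rfl

/-- Right ideals are closed under right multiplication. -/
theorem rightIdeal_mul_mem (I : Submodule Sᵐᵒᵖ S) {x : S} (hx : x ∈ I) (s : S) : x * s ∈ I :=
  I.smul_mem (MulOpposite.op s) hx

/-- An essential right ideal: it meets every nonzero right ideal. -/
def EssentialRight (E : Submodule Sᵐᵒᵖ S) : Prop :=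
  ∀ x : S, x ≠ 0 → ∃ s, x * s ≠ 0 ∧ x * s ∈ E

theorem EssentialRight.eq_bot {E U : Submodule Sᵐᵒᵖ S} (hE : EssentialRight E)
    (h : E ⊓ U = ⊥) : U = ⊥ := by
  rw [eq_bot_iff]
  intro x hx
  by_contra hne
  obtain ⟨s, hs0, hs⟩ := hE x hne
  have : x * s ∈ E ⊓ U := ⟨hs, rightIdeal_mul_mem U hx s⟩
  rw [h] at this
  exact hs0 this

variable [IsNoetherian Sᵐᵒᵖ S]

/-- Among the nonzero elements satisfying `p`, one has maximal right annihilator. -/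
theorem exists_maximal_rightAnn (p : S → Prop) (hp : ∃ z, p z) :
    ∃ z, p z ∧ ∀ y, p y → rightAnn z ≤ rightAnn y → rightAnn y ≤ rightAnn z := by
  obtain ⟨z, hz⟩ := hp
  obtain ⟨A, ⟨w, hw, rfl⟩, hA⟩ := set_has_maximal_iff_noetherian.2
    (inferInstance : IsNoetherian Sᵐᵒᵖ S) {A | ∃ z, p z ∧ rightAnn z = A} ⟨_, z, hz, rfl⟩
  refine ⟨w, hw, fun y hy hle => ?_⟩
  by_contra hn
  exact hA _ ⟨y, hy, rfl⟩ (lt_of_le_not_ge hle hn)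

/-- A prime right noetherian ring is right nonsingular. -/
theorem eq_zero_of_essential_rightAnn
    (hS : ∀ a b : S, (∀ r : S, a * r * b = 0) → a = 0 ∨ b = 0)
    {z : S} (hz : EssentialRight (rightAnn z)) : z = 0 := by
  by_contra hne
  obtain ⟨w, ⟨hw0, hw⟩, hmax⟩ := exists_maximal_rightAnn
    (fun z : S => z ≠ 0 ∧ EssentialRight (rightAnn z)) ⟨z, hne, hz⟩
  suffices h : ∀ s, w * s * w = 0 from (hS w w h).elim hw0 hw0
  intro s
  by_contra hs
  have hess : EssentialRight (rightAnn (w * s * w)) := by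
    intro x hx
    obtain ⟨t, ht0, ht⟩ := hw x hx
    refine ⟨t, ht0, ?_⟩
    rw [mem_rightAnn] at ht ⊢
    rw [mul_assoc, ht, mul_zero]
  have hle : rightAnn w ≤ rightAnn (w * s * w) := by
    intro x hx
    rw [mem_rightAnn] at hx ⊢
    rw [mul_assoc, hx, mul_zero]
  have hsw : s * w ≠ 0 := fun h => hs (by rw [mul_assoc, h, mul_zero])
  obtain ⟨t, ht0, ht⟩ := hw (s * w) hsw
  rw [mem_rightAnn] at ht
  have h1 : t ∈ rightAnn (w * s * w) := by
    rw [mem_rightAnn]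
    simpa [mul_assoc] using ht
  have h2 : w * t = 0 := hmax _ ⟨hs, hess⟩ hle h1
  exact ht0 (by rw [mul_assoc, h2, mul_zero])

/-- A prime right noetherian ring has no nonzero nil right ideals. -/
theorem exists_not_isNilpotent
    (hS : ∀ a b : S, (∀ r : S, a * r * b = 0) → a = 0 ∨ b = 0)
    {N : Submodule Sᵐᵒᵖ S} (hN : N ≠ ⊥) : ∃ x ∈ N, ¬ IsNilpotent x := by
  by_contra! hnil
  obtain ⟨a, ha, ha0⟩ := N.ne_bot_iff.1 hN
  have hSa : ∀ s, IsNilpotent (s * a) := by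
    intro s
    obtain ⟨j, hj⟩ := hnil (a * s) (rightIdeal_mul_mem N ha s)
    refine ⟨j + 1, ?_⟩
    rw [pow_succ, ← mul_assoc, mul_pow_mul, hj, mul_zero, zero_mul]
  obtain ⟨b, ⟨hb0, u, rfl⟩, hmax⟩ := exists_maximal_rightAnn
    (fun z : S => z ≠ 0 ∧ ∃ u, z = u * a) ⟨a, ha0, 1, (one_mul a).symm⟩
  suffices h : ∀ s, u * a * s * (u * a) = 0 from (hS _ _ h).elim hb0 hb0
  intro s
  by_cases hsb : s * (u * a) = 0
  · rw [mul_assoc, hsb, mul_zero]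
  classical
  have hex : ∃ j, (s * (u * a)) ^ (j + 1) = 0 := by
    obtain ⟨j, hj⟩ := hSa (s * u)
    exact ⟨j, by rw [pow_succ, ← mul_assoc s, hj, zero_mul]⟩
  obtain ⟨j, hj⟩ : ∃ j, Nat.find hex = j + 1 :=
    Nat.exists_eq_succ_of_ne_zero (fun h => hsb (by simpa [h] using Nat.find_spec hex))
  have h0 : (s * (u * a)) ^ (j + 1) ≠ 0 := Nat.find_min hex (by omega)
  have h1 : (s * (u * a)) ^ (j + 1) * (s * (u * a)) = 0 := by
    rw [← pow_succ, ← hj]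
    exact Nat.find_spec hex
  have h2 := hmax ((s * (u * a)) ^ (j + 1))
    ⟨h0, (s * (u * a)) ^ j * (s * u), by simp only [pow_succ, mul_assoc]⟩ (by
      intro x hx
      rw [mem_rightAnn] at hx ⊢
      rw [pow_succ, mul_assoc, mul_assoc s, hx, mul_zero, mul_zero])
  have h3 : u * a * (s * (u * a)) = 0 := h2 h1
  rw [mul_assoc, h3]

/-- Every nonzero right ideal contains a nonzero `b` such that `b` and `b * b` have the same right
annihilator. -/
theorem exists_rightAnn_sq_eq
    (hS : ∀ a b : S, (∀ r : S, a * r * b = 0) → a = 0 ∨ b = 0)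
    {N : Submodule Sᵐᵒᵖ S} (hN : N ≠ ⊥) :
    ∃ b ∈ N, b ≠ 0 ∧ ∀ x, b * (b * x) = 0 → b * x = 0 := by
  obtain ⟨x, hx, hnil⟩ := exists_not_isNilpotent hS hN
  obtain ⟨z, ⟨j, rfl⟩, hmax⟩ := exists_maximal_rightAnn
    (fun z : S => ∃ j, z = x ^ (j + 1)) ⟨_, 0, rfl⟩
  refine ⟨x ^ (j + 1), ?_, fun h => hnil ⟨_, h⟩, fun y hy => ?_⟩
  · rw [pow_succ']
    exact rightIdeal_mul_mem N hx _
  · refine hmax (x ^ (j + 1) * x ^ (j + 1)) ⟨j + 1 + j, by rw [← pow_add]; rfl⟩ ?_ ?_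
    · intro t ht
      rw [mem_rightAnn] at ht ⊢
      rw [mul_assoc, ht, mul_zero]
    · rw [mem_rightAnn, mul_assoc, hy]

/-- An essential right ideal contains an element with zero right annihilator. -/
theorem EssentialRight.exists_rightAnn_eq_bot
    (hS : ∀ a b : S, (∀ r : S, a * r * b = 0) → a = 0 ∨ b = 0)
    {E : Submodule Sᵐᵒᵖ S} (hE : EssentialRight E) : ∃ a ∈ E, rightAnn a = ⊥ := by
  obtain ⟨D, ⟨a, haE, haD, hD⟩, hmax⟩ := set_has_maximal_iff_noetherian.2
    (inferInstance : IsNoetherian Sᵐᵒᵖ S)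
    {D | ∃ a ∈ E, (∀ x, a * x ∈ D) ∧ ∀ d ∈ D, a * d = 0 → d = 0}
    ⟨⊥, 0, E.zero_mem, by simp, by simp⟩
  refine ⟨a, haE, hE.eq_bot ?_⟩
  by_contra hne
  obtain ⟨b, ⟨hbE, hab⟩, hb0, hb⟩ := exists_rightAnn_sq_eq hS hne
  replace hab : a * b = 0 := hab
  have hsplit : ∀ y, (a + b) * y = 0 → a * y = 0 ∧ b * y = 0 := by
    intro y hy
    rw [add_mul] at hy
    have h1 : a * y = 0 := by
      refine hD _ (haD y) ?_
      rw [eq_neg_of_add_eq_zero_left hy, mul_neg, ← mul_assoc, hab, zero_mul, neg_zero]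
    exact ⟨h1, by simpa [h1] using hy⟩
  refine hmax (D ⊔ LinearMap.range (lmulHom S b))
    ⟨a + b, E.add_mem haE hbE, fun x => ?_, fun v hv h0 => ?_⟩ ?_
  · rw [add_mul]
    exact Submodule.add_mem_sup (haD x) ⟨x, rfl⟩
  · obtain ⟨d, hd, _, ⟨x, rfl⟩, rfl⟩ := Submodule.mem_sup.1 hv
    change (a + b) * (d + b * x) = 0 at h0
    change d + b * x = 0
    obtain ⟨h1, h2⟩ := hsplit _ h0
    have hd0 : d = 0 := by
      refine hD d hd ?_
      rwa [mul_add, ← mul_assoc a b, hab, zero_mul, add_zero] at h1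
    rw [hd0, zero_add] at h2 ⊢
    exact hb x h2
  · refine lt_of_le_not_ge le_sup_left fun hle => hb0 (hD b (hle ?_) hab)
    exact Submodule.mem_sup_right ⟨1, mul_one b⟩

/-- If `a` has zero right annihilator then `a S` is essential. -/
theorem essentialRight_range {a : S} (ha : rightAnn a = ⊥) :
    EssentialRight (LinearMap.range (lmulHom S a)) := by
  intro x hx
  by_contra! h
  let U : Submodule Sᵐᵒᵖ S := LinearMap.range (lmulHom S x)
  have hinj : Function.Injective ((lmulHom S a).coprod U.subtype) := by
    rw [← LinearMap.ker_eq_bot, LinearMap.ker_eq_bot']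
    rintro ⟨y, _, t, rfl⟩ hyt
    change a * y + x * t = 0 at hyt
    have hxt : x * t = 0 := by
      by_contra hne
      exact h t hne ⟨-y, by
        change a * -y = x * t
        rw [mul_neg, eq_neg_of_add_eq_zero_left hyt, neg_neg]⟩
    rw [hxt, add_zero] at hyt
    have hy : y ∈ rightAnn a := hyt
    rw [ha, Submodule.mem_bot] at hy
    exact Prod.ext hy (Subtype.ext hxt)
  have : Subsingleton U := (IsNoetherian.equivPUnitOfProdInjective _ hinj).toEquiv.subsingleton
  have h0 : (⟨x, 1, mul_one x⟩ : U) = 0 := Subsingleton.elim _ _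
  exact hx (congrArg Subtype.val h0)

/-- **Goldie**: an essential right ideal of a prime right noetherian ring contains a regular
element. -/
theorem EssentialRight.exists_regElem
    (hS : ∀ a b : S, (∀ r : S, a * r * b = 0) → a = 0 ∨ b = 0)
    {E : Submodule Sᵐᵒᵖ S} (hE : EssentialRight E) : ∃ a ∈ E, regElem S a := by
  obtain ⟨a, haE, ha⟩ := hE.exists_rightAnn_eq_bot hS
  refine ⟨a, haE, fun x hx => ?_, fun x hx => eq_zero_of_essential_rightAnn hS fun y hy => ?_⟩
  · have : x ∈ rightAnn a := hx
    rwa [ha] at this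
  · obtain ⟨s, hs0, t, ht⟩ := essentialRight_range ha y hy
    refine ⟨s, hs0, ?_⟩
    rw [mem_rightAnn, ← ht]
    change x * (a * t) = 0
    rw [← mul_assoc, hx, zero_mul]

/-- In a prime right noetherian ring `S`, if some nonzero right ideal has Krull dimension at most
`k`, then so does `S`. -/
theorem kdimLE_of_devLE_Iic
    (hS : ∀ a b : S, (∀ r : S, a * r * b = 0) → a = 0 ∨ b = 0) {k : ℕ}
    {U : Submodule Sᵐᵒᵖ S} (hU : U ≠ ⊥) (hk : devLE k (Set.Iic U)) : kdimLE S S k := by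
  obtain ⟨D, hD, hmax⟩ := set_has_maximal_iff_noetherian.2
    (inferInstance : IsNoetherian Sᵐᵒᵖ S) {D | devLE k (Set.Iic D)} ⟨U, hk⟩
  have hle : ∀ A : Submodule Sᵐᵒᵖ S, devLE k (Set.Iic A) → A ≤ D := by
    intro A hA
    by_contra hn
    exact hmax (D ⊔ A) (devLE.Iic_sup hD hA)
      (lt_of_le_not_ge le_sup_left fun h => hn (le_sup_right.trans h))
  have hleft : ∀ s, ∀ d ∈ D, s * d ∈ D := fun s d hd =>
    hle _ (devLE.Iic_map (lmulHom S s) hD) ⟨d, hd, rfl⟩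
  obtain ⟨u, huU, hu0⟩ := U.ne_bot_iff.1 hU
  have hess : EssentialRight D := by
    intro x hx
    by_contra! h
    refine (hS x u fun r => ?_).elim hx hu0
    by_contra hne
    rw [mul_assoc] at hne
    refine h _ hne (hleft _ _ (hleft _ _ (hle U hk huU)))
  obtain ⟨a, haD, ha, -⟩ := hess.exists_regElem hS
  have hinj : Function.Injective (lmulHom S a) := by
    rw [← LinearMap.ker_eq_bot, LinearMap.ker_eq_bot']
    exact ha
  refine devLE.of_strictMono (B := Set.Iic D) (fun X => ⟨X.map (lmulHom S a), ?_⟩)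
    (fun X Y h => Submodule.map_strictMono_of_injective hinj h) hD
  rintro _ ⟨x, -, rfl⟩
  exact rightIdeal_mul_mem D haD x

/-- In a prime right noetherian ring, a right ideal whose quotient has Krull dimension smaller than
that of the ring contains a regular element. -/
theorem exists_regElem_of_kdimLE_quotient
    (hS : ∀ a b : S, (∀ r : S, a * r * b = 0) → a = 0 ∨ b = 0) {k : ℕ}
    {J : Submodule Sᵐᵒᵖ S} (hJ : devLE k (Set.Ici J)) (hk : ¬ kdimLE S S k) :
    ∃ a ∈ J, regElem S a := by
  refine EssentialRight.exists_regElem hS fun x hx => ?_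
  by_contra! h
  refine hk (kdimLE_of_devLE_Iic hS (U := LinearMap.range (lmulHom S x)) ?_
    (devLE.Iic_of_Ici ?_ hJ))
  · refine (Submodule.ne_bot_iff _).2 ⟨x, ⟨1, mul_one x⟩, hx⟩
  · rw [Submodule.disjoint_def]
    rintro _ ⟨s, rfl⟩ hs
    by_contra hne
    exact h s hne hs

end Goldie

/-- A ring homomorphism as a semilinear map of right modules. -/
def rightSemilinear {R S : Type*} [Ring R] [Ring S] (φ : R →+* S) : R →ₛₗ[RingHom.op φ] S where
  toFun := φ
  map_add' := map_add φ
  map_smul' r x := by simp [MulOpposite.smul_eq_mul_unop]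

/-- A right ideal `I` with `Kdim (R/I) ≤ k` meets `C(P)` for every prime `P` with
`Kdim (R/P)` not at most `k`. -/
theorem exists_regModP {R : Type*} [Ring R] [IsNoetherian Rᵐᵒᵖ R] {k : ℕ}
    {I P : Submodule Rᵐᵒᵖ R} (hP : isTwoSidedPrime R P) (hI : kdimLE R (R ⧸ I) k)
    (hPk : ¬ kdimLE R (R ⧸ P) k) : ∃ t ∈ I, regModP R P t := by
  obtain ⟨hleft, -, hprime⟩ := hP
  let P' : Ideal R := { P.toAddSubmonoid with smul_mem' := fun r a ha => hleft a ha r }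
  have : P'.IsTwoSided := ⟨fun {a} b ha => rightIdeal_mul_mem P ha b⟩
  let φ : R →+* R ⧸ P' := Ideal.Quotient.mk P'
  have hφ : Function.Surjective φ := Ideal.Quotient.mk_surjective
  have hφ0 : ∀ x, φ x = 0 ↔ x ∈ P := fun x => Ideal.Quotient.eq_zero_iff_mem
  have : RingHomSurjective (RingHom.op φ) := ⟨fun y => by
    obtain ⟨x, hx⟩ := hφ y.unop
    exact ⟨MulOpposite.op x, MulOpposite.unop_injective hx⟩⟩
  let G := rightSemilinear φ
  have hG : Function.Surjective G := hφ
  have hker : LinearMap.ker G = P := Submodule.ext hφ0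
  have : IsNoetherian (R ⧸ P')ᵐᵒᵖ (R ⧸ P') :=
    isNoetherian_of_surjective G (LinearMap.range_eq_top.2 hG)
  have hS : ∀ a b : R ⧸ P', (∀ r, a * r * b = 0) → a = 0 ∨ b = 0 := by
    intro a b h
    obtain ⟨a, rfl⟩ := hφ a
    obtain ⟨b, rfl⟩ := hφ b
    rw [hφ0, hφ0]
    exact hprime a b fun r => by rw [← hφ0, map_mul, map_mul, h]
  have hJ : devLE k (Set.Ici (I.map G)) := by
    refine devLE.of_strictMono (fun X => ⟨X.1.comap G, Submodule.map_le_iff_le_comap.1 X.2⟩) ?_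
      ((kdimLE_quotient_iff I k).1 hI)
    exact Monotone.strictMono_of_injective (fun X Y h => Submodule.comap_mono h)
      fun X Y h => Subtype.ext (Submodule.comap_injective_of_surjective hG
        (congrArg (fun p => p.1) h))
  have hk : ¬ kdimLE (R ⧸ P') (R ⧸ P') k := by
    intro h
    refine hPk ((kdimLE_quotient_iff P k).2 (devLE.of_strictMono (fun X => X.1.map G) ?_ h))
    refine Monotone.strictMono_of_injective (fun X Y h => Submodule.map_mono h) fun X Y h => ?_
    have h1 := congrArg (Submodule.comap G) h
    simp only [Submodule.comap_map_eq, hker] at h1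
    rw [sup_eq_left.2 X.2, sup_eq_left.2 Y.2] at h1
    exact Subtype.ext h1
  obtain ⟨_, ⟨t, htI, rfl⟩, h1, h2⟩ := exists_regElem_of_kdimLE_quotient hS hJ hk
  refine ⟨t, htI, fun x => ⟨fun hx => ?_, fun hx => ?_⟩⟩
  · rw [← hφ0, map_mul] at hx
    exact (hφ0 x).1 (h1 _ hx)
  · rw [← hφ0, map_mul] at hx
    exact (hφ0 x).1 (h2 _ hx)

theorem stmt5 (R : Type) [Ring R] [Nontrivial R] [IsNoetherian Rᵐᵒᵖ R]
    (hprime : ∀ a b : R, (∀ r : R, a * r * b = 0) → a = 0 ∨ b = 0)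
    (n m : ℕ) (hm : 0 < m) (hmn : m < n)
    (hdim : kdimLE R R n ∧ ¬ kdimLE R R (n - 1)) :
    {I : Submodule Rᵐᵒᵖ R | ∃ t ∈ rCm R m, t ∈ I} ⊆ gFilt R m ∧
      gFilt R m ⊆ {I : Submodule Rᵐᵒᵖ R | ∀ P ∈ xSet R m, ∃ t ∈ I, regModP R P t} := by
  refine ⟨?_, fun I hI P hP => exists_regModP hP.1 hI hP.2.2⟩
  rintro I ⟨t, ht, htI⟩
  have hle : Submodule.span Rᵐᵒᵖ {t} ≤ I := (Submodule.span_singleton_le_iff_mem t I).2 htI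
  refine (kdimLE_quotient_iff I _).2 (devLE.of_strictMono
    (fun X => ⟨X.1, hle.trans X.2⟩) (fun X Y h => h) ((kdimLE_quotient_iff _ _).1 ht))
end
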